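/- arXiv:1307.3215 — 2 statements merged into one kernel-verified Lean document; each statement's English description precedes it below -/
import Mathlib

section
/- The cubic surface S₁ has exactly 121 points over the field 𝔽₈ with eight elements: the number of points [v] of ℙ³(𝔽₈) with f₁(v) = 0 equals 121 (equivalently, the number of nonzero vectors v ∈ 𝔽₈⁴ with f₁(v) = 0 equals 847). -/
open MvPolynomial

/-- The cubic form `Y³ + Y²Z + Z³ + W(X² + Y² + YZ + Z²) + XW² + W³` with the variables
`X, Y, Z, W` indexed by `0, 1, 2, 3`, over any commutative ring (its coefficients lie in `𝔽₂`). -/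
noncomputable def f₁ (K : Type*) [CommRing K] : MvPolynomial (Fin 4) K :=
  X 1 ^ 3 + X 1 ^ 2 * X 2 + X 2 ^ 3
    + X 3 * (X 0 ^ 2 + X 1 ^ 2 + X 1 * X 2 + X 2 ^ 2) + X 0 * X 3 ^ 2 + X 3 ^ 3

/-- The field `𝔽₂[α]/(α³ + α + 1)`, the triple `(a, b, c)` standing for `a + bα + cα²`. -/
def F8 : Type := Bool × Bool × Bool

namespace F8

instance : DecidableEq F8 := inferInstanceAs (DecidableEq (Bool × Bool × Bool))

instance : Fintype F8 := inferInstanceAs (Fintype (Bool × Bool × Bool))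

instance : Zero F8 := ⟨(false, false, false)⟩

instance : One F8 := ⟨(true, false, false)⟩

instance : Add F8 := ⟨fun x y => (x.1 ^^ y.1, x.2.1 ^^ y.2.1, x.2.2 ^^ y.2.2)⟩

instance : Neg F8 := ⟨id⟩

instance : Mul F8 := ⟨fun x y =>
  let r := (x.2.1 && y.2.2) ^^ (x.2.2 && y.2.1)
  let s := x.2.2 && y.2.2
  ((x.1 && y.1) ^^ r,
    (x.1 && y.2.1) ^^ (x.2.1 && y.1) ^^ r ^^ s,
    (x.1 && y.2.2) ^^ (x.2.1 && y.2.1) ^^ (x.2.2 && y.1) ^^ s)⟩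

instance : Inv F8 := ⟨fun x => x * x * (x * x) * (x * x)⟩

instance : Field F8 where
  add_assoc := by decide +kernel
  zero_add := by decide +kernel
  add_zero := by decide +kernel
  add_comm := by decide +kernel
  nsmul := nsmulRec
  zsmul := zsmulRec
  neg_add_cancel := by decide +kernel
  mul_assoc := by decide +kernel
  one_mul := by decide +kernel
  mul_one := by decide +kernel
  mul_comm := by decide +kernel
  left_distrib := by decide +kernel
  right_distrib := by decide +kernel
  zero_mul := by decide +kernel
  mul_zero := by decide +kernel
  exists_pair_ne := ⟨0, 1, by decide⟩
  mul_inv_cancel := by decide +kernel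
  inv_zero := by decide +kernel
  nnqsmul := _
  nnqsmul_def := fun _ _ => rfl
  qsmul := _
  qsmul_def := fun _ _ => rfl

end F8

/-- The cubic form `f₁` as a function of its four variables. -/
def cubicForm {K : Type*} [CommRing K] (x y z w : K) : K :=
  y * y * y + y * y * z + z * z * z + w * (x * x + y * y + y * z + z * z) + x * (w * w) + w * w * w

lemma eval_f₁ {K : Type*} [CommRing K] (v : Fin 4 → K) :
    eval v (f₁ K) = cubicForm (v 0) (v 1) (v 2) (v 3) := by
  simp only [f₁, cubicForm, map_add, map_mul, map_pow, eval_X]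
  ring

lemma eval_smul_f₁ {K : Type*} [CommRing K] (a : K) (v : Fin 4 → K) :
    eval (a • v) (f₁ K) = a ^ 3 * eval v (f₁ K) := by
  simp only [eval_f₁, cubicForm, Pi.smul_apply, smul_eq_mul]
  ring

lemma map_cubicForm {K L : Type*} [CommRing K] [CommRing L] (φ : K →+* L) (x y z w : K) :
    φ (cubicForm x y z w) = cubicForm (φ x) (φ y) (φ z) (φ w) := by
  simp [cubicForm]

lemma card_cubicForm_F8 :
    (Finset.univ.filter fun p : F8 × F8 × F8 × F8 =>
      p ≠ 0 ∧ cubicForm p.1 p.2.1 p.2.2.1 p.2.2.2 = 0).card = 847 := by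
  decide +kernel

/-- Coordinatewise application of an equivalence, with values in iterated pairs. -/
def finFourArrowEquiv {K L : Type*} (e : K ≃ L) : (Fin 4 → K) ≃ L × L × L × L where
  toFun v := (e (v 0), e (v 1), e (v 2), e (v 3))
  invFun p := ![e.symm p.1, e.symm p.2.1, e.symm p.2.2.1, e.symm p.2.2.2]
  left_inv v := by ext i; fin_cases i <;> simp
  right_inv p := by simp

lemma ncard_affineCone_f₁ {K : Type*} [Field K] [Fintype K] (hK : Fintype.card K = 8) :
    {v : Fin 4 → K | v ≠ 0 ∧ eval v (f₁ K) = 0}.ncard = 847 := by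
  have φ : K ≃+* F8 := FiniteField.ringEquivOfCardEq (hK.trans (by decide))
  rw [← card_cubicForm_F8, ← Set.ncard_coe_finset,
    ← Set.ncard_image_of_injective _ (finFourArrowEquiv φ.toEquiv).injective]
  congr 1
  rw [Equiv.image_eq_preimage_symm]
  ext p
  obtain ⟨v, rfl⟩ := (finFourArrowEquiv φ.toEquiv).surjective p
  have h0 : finFourArrowEquiv φ.toEquiv v = 0 ↔ v = 0 := by
    simp [finFourArrowEquiv, Prod.ext_iff, funext_iff, Fin.forall_fin_succ]
  have hφ := map_cubicForm (φ : K →+* F8) (v 0) (v 1) (v 2) (v 3)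
  simp only [Set.mem_preimage, Equiv.symm_apply_apply, Set.mem_ofPred_eq, Finset.coe_filter,
    Finset.mem_univ, true_and, ne_eq, h0, eval_f₁]
  rw [← map_eq_zero_iff φ φ.injective]
  exact and_congr_right fun _ => by
    rw [show φ _ = _ from hφ]
    rfl

/-- Each point of a projective set accounts for `#K - 1` nonzero vectors of its affine cone. -/
lemma Projectivization.ncard_mul_card_units {K V : Type*} [Field K] [AddCommGroup V] [Module K V]
    (P : V → Prop) (hP : ∀ (a : Kˣ) (v : V), P (a • v) ↔ P v) :
    {x : Projectivization K V | P x.rep}.ncard * Nat.card Kˣ = {v : V | v ≠ 0 ∧ P v}.ncard := by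
  rw [← Nat.card_coe_set_eq, ← Nat.card_coe_set_eq, ← Nat.card_prod]
  refine Nat.card_congr (Equiv.ofBijective
    (fun q => ⟨q.2 • q.1.1.rep, (smul_ne_zero_iff_ne q.2).2 q.1.1.rep_nonzero,
      (hP _ _).2 q.1.2⟩) ⟨?_, ?_⟩)
  · rintro ⟨⟨x, hx⟩, a⟩ ⟨⟨y, hy⟩, b⟩ h
    have h' : a • x.rep = b • y.rep := congrArg Subtype.val h
    obtain rfl : x = y := by
      rw [← x.mk_rep, ← y.mk_rep, Projectivization.mk_eq_mk_iff]
      exact ⟨a⁻¹ * b, by rw [mul_smul, ← h', inv_smul_smul]⟩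
    have hab : a = b := Units.ext (smul_left_injective K x.rep_nonzero h')
    rw [hab]
  · rintro ⟨v, hv, hPv⟩
    obtain ⟨a, ha⟩ := Projectivization.exists_smul_eq_mk_rep K v hv
    refine ⟨⟨⟨Projectivization.mk K v hv, ?_⟩, a⁻¹⟩, Subtype.ext ?_⟩
    · rw [Set.mem_ofPred_eq, ← ha]
      exact (hP a v).2 hPv
    · simp [← ha]

/-- The cubic surface `S₁` has exactly `121` points over the field `𝔽₈` with eight elements
(equivalently, exactly `847` nonzero vectors of `𝔽₈⁴` lie on the affine cone). -/
theorem S₁_card_points_over_F8 :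
    {x : Projectivization (GaloisField 2 3) (Fin 4 → GaloisField 2 3) |
        eval x.rep (f₁ (GaloisField 2 3)) = 0}.ncard = 121
      ∧ {v : Fin 4 → GaloisField 2 3 | v ≠ 0 ∧ eval v (f₁ (GaloisField 2 3)) = 0}.ncard = 847 := by
  have : Fintype (GaloisField 2 3) := Fintype.ofFinite _
  have hK : Nat.card (GaloisField 2 3) = 8 := by rw [GaloisField.card 2 3 (by decide)]; rfl
  have hcone := ncard_affineCone_f₁ (K := GaloisField 2 3) (by rw [Fintype.card_eq_nat_card, hK])
  refine ⟨?_, hcone⟩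
  have h := Projectivization.ncard_mul_card_units (K := GaloisField 2 3)
    (fun v : Fin 4 → GaloisField 2 3 => eval v (f₁ (GaloisField 2 3)) = 0) fun a v => by
      simp [Units.smul_def, eval_smul_f₁]
  rw [hcone, Nat.card_units, hK] at h
  lia
end

section
/- For each θ ∈ 𝔽₄ with θ² + θ + 1 = 0, all 27 lines of the cubic surface S₃(θ) are defined over 𝔽₆₄: there are exactly 27 two-dimensional 𝔽₆₄-linear subspaces W of 𝔽₆₄⁴ such that f₃ (with coefficients viewed in 𝔽₆₄ via an embedding 𝔽₄ → 𝔽₆₄) vanishes at every vector of W. -/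
open MvPolynomial

/-- The cubic form `X³ + Y³ + Z³ + θW³` with the variables `X, Y, Z, W` indexed by
`0, 1, 2, 3`, over any commutative ring `K` containing the coefficient `θ`. -/
noncomputable def f₃ (K : Type*) [CommRing K] (θ : K) : MvPolynomial (Fin 4) K :=
  X 0 ^ 3 + X 1 ^ 3 + X 2 ^ 3 + C θ * X 3 ^ 3

section FermatCubic

variable {K : Type*} [Field K]

/-- The subspace `x₀ = α xᵢ, xⱼ = β xₖ` of `K⁴`, where `{i, j, k} = {1, 2, 3}`, `i = p + 1` and
`j < k`. -/
def fermatLine (p : Fin 3) (α β : K) : Submodule K (Fin 4 → K) where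
  carrier := {x | x 0 = α * x p.succ ∧
    x (![2, 1, 1] p) = β * x (![3, 3, 2] p)}
  zero_mem' := by simp
  add_mem' := by
    rintro x y ⟨hx, hx'⟩ ⟨hy, hy'⟩
    simp only [Set.mem_ofPred_eq, Pi.add_apply]
    exact ⟨by rw [hx, hy]; ring, by rw [hx', hy']; ring⟩
  smul_mem' := by
    rintro c x ⟨hx, hx'⟩
    simp only [Set.mem_ofPred_eq, Pi.smul_apply, smul_eq_mul]
    exact ⟨by rw [hx]; ring, by rw [hx']; ring⟩

lemma mem_fermatLine_zero {α β : K} {x : Fin 4 → K} :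
    x ∈ fermatLine 0 α β ↔ x 0 = α * x 1 ∧ x 2 = β * x 3 := Iff.rfl

lemma mem_fermatLine_one {α β : K} {x : Fin 4 → K} :
    x ∈ fermatLine 1 α β ↔ x 0 = α * x 2 ∧ x 1 = β * x 3 := Iff.rfl

lemma mem_fermatLine_two {α β : K} {x : Fin 4 → K} :
    x ∈ fermatLine 2 α β ↔ x 0 = α * x 3 ∧ x 1 = β * x 2 := Iff.rfl

lemma finrank_fermatLine (p : Fin 3) (α β : K) :
    Module.finrank K (fermatLine p α β) = 2 := by
  let φ : fermatLine p α β →ₗ[K] K × K :=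
    (((LinearMap.proj p.succ).prod (LinearMap.proj (![3, 3, 2] p))) :
      (Fin 4 → K) →ₗ[K] K × K).comp (fermatLine p α β).subtype
  have hφ : Function.Bijective φ := by
    constructor
    · rw [← LinearMap.ker_eq_bot, LinearMap.ker_eq_bot']
      rintro ⟨x, hx⟩ h
      obtain ⟨h1, h2⟩ := Prod.ext_iff.mp h
      rw [Submodule.mk_eq_zero]
      fin_cases p
      · obtain ⟨h3, h4⟩ := mem_fermatLine_zero.mp hx
        change x 1 = 0 at h1
        change x 3 = 0 at h2
        ext i; fin_cases i <;> simp [*]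
      · obtain ⟨h3, h4⟩ := mem_fermatLine_one.mp hx
        change x 2 = 0 at h1
        change x 3 = 0 at h2
        ext i; fin_cases i <;> simp [*]
      · obtain ⟨h3, h4⟩ := mem_fermatLine_two.mp hx
        change x 3 = 0 at h1
        change x 2 = 0 at h2
        ext i; fin_cases i <;> simp [*]
    · rintro ⟨r, s⟩
      fin_cases p
      · exact ⟨⟨![α * r, r, β * s, s], mem_fermatLine_zero.mpr ⟨rfl, rfl⟩⟩, rfl⟩
      · exact ⟨⟨![α * r, β * s, r, s], mem_fermatLine_one.mpr ⟨rfl, rfl⟩⟩, rfl⟩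
      · exact ⟨⟨![α * r, β * s, s, r], mem_fermatLine_two.mpr ⟨rfl, rfl⟩⟩, rfl⟩
  rw [(LinearEquiv.ofBijective φ hφ).finrank_eq, Module.finrank_prod, Module.finrank_self]

lemma eq_of_fermatLine_eq {p q : Fin 3} {α β γ δ : K} (hα : α ≠ 0)
    (h : fermatLine p α β = fermatLine q γ δ) : p = q ∧ α = γ ∧ β = δ := by
  fin_cases p
  · have h1 : ![α, 1, 0, 0] ∈ fermatLine 0 α β := by simp [mem_fermatLine_zero]
    have h2 : ![0, 0, β, 1] ∈ fermatLine 0 α β := by simp [mem_fermatLine_zero]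
    replace h1 := h.le h1
    replace h2 := h.le h2
    fin_cases q
    · simp_all [mem_fermatLine_zero]
    · simp_all [mem_fermatLine_one]
    · simp_all [mem_fermatLine_two]
  · have h1 : ![α, 0, 1, 0] ∈ fermatLine 1 α β := by simp [mem_fermatLine_one]
    have h2 : ![0, β, 0, 1] ∈ fermatLine 1 α β := by simp [mem_fermatLine_one]
    replace h1 := h.le h1
    replace h2 := h.le h2
    fin_cases q
    · simp_all [mem_fermatLine_zero]
    · simp_all [mem_fermatLine_one]
    · simp_all [mem_fermatLine_two]
  · have h1 : ![α, 0, 0, 1] ∈ fermatLine 2 α β := by simp [mem_fermatLine_two]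
    have h2 : ![0, β, 1, 0] ∈ fermatLine 2 α β := by simp [mem_fermatLine_two]
    replace h1 := h.le h1
    replace h2 := h.le h2
    fin_cases q
    · simp_all [mem_fermatLine_zero]
    · simp_all [mem_fermatLine_one]
    · simp_all [mem_fermatLine_two]

variable [CharP K 2]

lemma fermat_eq_zero_of_mem_fermatLine {p : Fin 3} {α β : K} (hα : α ^ 3 = 1) (hβ : β ^ 3 = 1)
    {x : Fin 4 → K} (hx : x ∈ fermatLine p α β) :
    x 0 ^ 3 + x 1 ^ 3 + x 2 ^ 3 + x 3 ^ 3 = 0 := by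
  have h2 : (2 : K) = 0 := CharTwo.two_eq_zero
  fin_cases p
  · obtain ⟨h, h'⟩ := mem_fermatLine_zero.mp hx
    rw [h, h']
    linear_combination x 1 ^ 3 * hα + x 3 ^ 3 * hβ + (x 1 ^ 3 + x 3 ^ 3) * h2
  · obtain ⟨h, h'⟩ := mem_fermatLine_one.mp hx
    rw [h, h']
    linear_combination x 2 ^ 3 * hα + x 3 ^ 3 * hβ + (x 2 ^ 3 + x 3 ^ 3) * h2
  · obtain ⟨h, h'⟩ := mem_fermatLine_two.mp hx
    rw [h, h']
    linear_combination x 3 ^ 3 * hα + x 2 ^ 3 * hβ + (x 2 ^ 3 + x 3 ^ 3) * h2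

/-- Polarization of the Fermat cubic form on a subspace where it vanishes. -/
lemma fermat_polar_eq_zero {t : K} (ht : t ^ 2 + t + 1 = 0) {W : Submodule K (Fin 4 → K)}
    {i j k l : Fin 4} (hW : ∀ v ∈ W, v i ^ 3 + v j ^ 3 + v k ^ 3 + v l ^ 3 = 0)
    {u v : Fin 4 → K} (hu : u ∈ W) (hv : v ∈ W) :
    u i * v i ^ 2 + u j * v j ^ 2 + u k * v k ^ 2 + u l * v l ^ 2 = 0 := by
  have h2 : (2 : K) = 0 := CharTwo.two_eq_zero
  have e1 := hW u hu
  have e2 := hW v hv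
  have e3 := hW _ (W.add_mem hu hv)
  have e4 := hW _ (W.add_mem hu (W.smul_mem t hv))
  simp only [Pi.add_apply, Pi.smul_apply, smul_eq_mul] at e3 e4
  have ht1 : t ^ 2 - t ≠ 0 := by
    intro h
    have : (1 : K) = 0 := by linear_combination ht - h - t * h2
    exact one_ne_zero this
  have key : (t ^ 2 - t) * (u i * v i ^ 2 + u j * v j ^ 2 + u k * v k ^ 2 + u l * v l ^ 2) = 0 := by
    set A := u i ^ 2 * v i + u j ^ 2 * v j + u k ^ 2 * v k + u l ^ 2 * v l with hA
    set B := u i * v i ^ 2 + u j * v j ^ 2 + u k * v k ^ 2 + u l * v l ^ 2 with hB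
    have e5 : A + B = 0 := by
      linear_combination e3 - e1 - e2 - (A + B) * h2
    have e6 : t * A + t ^ 2 * B = 0 := by
      linear_combination e4 - e1 - t ^ 3 * e2 - (t * A + t ^ 2 * B) * h2
    linear_combination e6 - t * e5
  exact (mul_eq_zero.mp key).resolve_left ht1

lemma fermat_coordinates_proportional {t : K} (ht : t ^ 2 + t + 1 = 0)
    {W : Submodule K (Fin 4 → K)} (hd : Module.finrank K W = 2) {i j k l : Fin 4}
    (hW : ∀ v ∈ W, v i ^ 3 + v j ^ 3 + v k ^ 3 + v l ^ 3 = 0)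
    (hinj : ∀ w ∈ W, w i = 0 → w j = 0 → w = 0) :
    (∃ a b : K, a ^ 3 = 1 ∧ b ^ 3 = 1 ∧ ∀ w ∈ W, w i = a * w k ∧ w j = b * w l) ∨
    (∃ a b : K, a ^ 3 = 1 ∧ b ^ 3 = 1 ∧ ∀ w ∈ W, w i = a * w l ∧ w j = b * w k) := by
  have h2 : (2 : K) = 0 := CharTwo.two_eq_zero
  let φ : W →ₗ[K] K × K :=
    (((LinearMap.proj i).prod (LinearMap.proj j)) :
      (Fin 4 → K) →ₗ[K] K × K).comp W.subtype
  have hφ : Function.Injective φ := by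
    rw [← LinearMap.ker_eq_bot, LinearMap.ker_eq_bot']
    rintro ⟨x, hx⟩ h
    obtain ⟨h1, h2⟩ := Prod.ext_iff.mp h
    rw [Submodule.mk_eq_zero]
    exact hinj x hx h1 h2
  have hsurj : Function.Surjective φ :=
    (LinearMap.injective_iff_surjective_of_finrank_eq_finrank
      (by rw [hd, Module.finrank_prod, Module.finrank_self])).mp hφ
  obtain ⟨⟨u, hu⟩, hu'⟩ := hsurj (1, 0)
  obtain ⟨⟨v, hv⟩, hv'⟩ := hsurj (0, 1)
  obtain ⟨hui : u i = 1, huj : u j = 0⟩ := Prod.ext_iff.mp hu'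
  obtain ⟨hvi : v i = 0, hvj : v j = 1⟩ := Prod.ext_iff.mp hv'
  have hspan : ∀ w ∈ W, w = w i • u + w j • v := by
    intro w hw
    rw [← sub_eq_zero]
    refine hinj _ (W.sub_mem hw (W.add_mem (W.smul_mem _ hu) (W.smul_mem _ hv))) ?_ ?_ <;>
      simp [*]
  have hk : ∀ w ∈ W, w k = w i * u k + w j * v k := fun w hw ↦ congrFun (hspan w hw) k
  have hl : ∀ w ∈ W, w l = w i * u l + w j * v l := fun w hw ↦ congrFun (hspan w hw) l
  have e1 := hW u hu
  have e2 := hW v hv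
  have e3 := fermat_polar_eq_zero ht hW hu hv
  have e4 := fermat_polar_eq_zero ht hW hv hu
  rw [hui, huj] at e1 e3 e4
  rw [hvi, hvj] at e2 e3 e4
  generalize u k = a at *
  generalize u l = c at *
  generalize v k = b at *
  generalize v l = d at *
  have key : a * b * (a * d - b * c) = 0 := by
    linear_combination d * e4 - c * e3
  rcases mul_eq_zero.mp key with h | h
  · rcases mul_eq_zero.mp h with rfl | rfl
    · have hc : c ^ 3 = 1 := by linear_combination e1 - h2
      have hc0 : c ≠ 0 := by rintro rfl; simp at hc
      have hd0 : d = 0 := by simpa [hc0] using e4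
      subst hd0
      have hb : b ^ 3 = 1 := by linear_combination e2 - h2
      refine Or.inr ⟨c ^ 2, b ^ 2, by linear_combination (c ^ 3 + 1) * hc,
        by linear_combination (b ^ 3 + 1) * hb, fun w hw ↦ ⟨?_, ?_⟩⟩
      · rw [hl w hw]; linear_combination - w i * hc
      · rw [hk w hw]; linear_combination - w j * hb
    · have hd' : d ^ 3 = 1 := by linear_combination e2 - h2
      have hd0 : d ≠ 0 := by rintro rfl; simp at hd'
      have hc0 : c = 0 := by simpa [hd0] using e3
      subst hc0
      have ha : a ^ 3 = 1 := by linear_combination e1 - h2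
      refine Or.inl ⟨a ^ 2, d ^ 2, by linear_combination (a ^ 3 + 1) * ha,
        by linear_combination (d ^ 3 + 1) * hd', fun w hw ↦ ⟨?_, ?_⟩⟩
      · rw [hk w hw]; linear_combination - w i * ha
      · rw [hl w hw]; linear_combination - w j * hd'
  · exfalso
    have hb : b = 0 := by linear_combination b * e1 - a * e4 + c ^ 2 * h
    have hd0 : d = 0 := by linear_combination d * e1 - c * e4 - a ^ 2 * h
    simp [hb, hd0] at e2

lemma exists_le_fermatLine {t : K} (ht : t ^ 2 + t + 1 = 0)
    {W : Submodule K (Fin 4 → K)} (hd : Module.finrank K W = 2)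
    (hW : ∀ v ∈ W, v 0 ^ 3 + v 1 ^ 3 + v 2 ^ 3 + v 3 ^ 3 = 0) :
    ∃ (p : Fin 3) (α β : K), α ^ 3 = 1 ∧ β ^ 3 = 1 ∧ W ≤ fermatLine p α β := by
  have hW' : ∀ v ∈ W, v 0 ^ 3 + v 2 ^ 3 + v 1 ^ 3 + v 3 ^ 3 = 0 := fun v hv ↦ by
    linear_combination hW v hv
  by_cases h01 : ∀ w ∈ W, w 0 = 0 → w 1 = 0 → w = 0
  · rcases fermat_coordinates_proportional ht hd hW h01 with ⟨a, b, ha, hb, h⟩ | ⟨a, b, ha, hb, h⟩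
    · exact ⟨1, a, b, ha, hb, h⟩
    · exact ⟨2, a, b, ha, hb, h⟩
  by_cases h02 : ∀ w ∈ W, w 0 = 0 → w 2 = 0 → w = 0
  · rcases fermat_coordinates_proportional ht hd hW' h02 with
      ⟨a, b, ha, hb, h⟩ | ⟨a, b, ha, hb, h⟩
    · exact ⟨0, a, b, ha, hb, h⟩
    · refine ⟨2, a, b ^ 2, ha, by linear_combination (b ^ 3 + 1) * hb, fun w hw ↦ ?_⟩
      obtain ⟨h1, h2⟩ := h w hw
      exact mem_fermatLine_two.mpr ⟨h1, by rw [h2]; linear_combination - w 1 * hb⟩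
  exfalso
  push Not at h01 h02
  obtain ⟨u, hu, hu0, hu1, hu'⟩ := h01
  obtain ⟨v, hv, hv0, hv2, hv'⟩ := h02
  have e1 := hW u hu
  have e2 := hW v hv
  have e3 := fermat_polar_eq_zero ht hW hu hv
  have hu3 : u 3 ≠ 0 := by
    intro h
    have h2 : u 2 = 0 := by simpa [hu0, hu1, h] using e1
    exact hu' (by ext i; fin_cases i <;> simp [*])
  have hv3 : v 3 ≠ 0 := by
    intro h
    have h2 : v 1 = 0 := by simpa [hv0, hv2, h] using e2
    exact hv' (by ext i; fin_cases i <;> simp [*])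
  simp [hu0, hu1, hv2, hu3, hv3] at e3

lemma ncard_cubeRoots_one {t : K} (ht : t ^ 2 + t + 1 = 0) :
    {a : K | a ^ 3 = 1}.ncard = 3 := by
  have h2 : (2 : K) = 0 := CharTwo.two_eq_zero
  have ht0 : t ≠ 0 := by rintro rfl; simp at ht
  have ht1 : t ≠ 1 := by
    rintro rfl
    exact one_ne_zero (α := K) (by linear_combination ht - h2)
  have : {a : K | a ^ 3 = 1} = {1, t, t + 1} := by
    ext a
    simp only [Set.mem_ofPred_eq, Set.mem_insert_iff, Set.mem_singleton_iff]
    constructor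
    · intro h
      have : (a - 1) * ((a - t) * (a - (t + 1))) = 0 := by
        linear_combination h + (a - 1) * ht - (a - 1) * ((t + 1) * a + 1) * h2
      simpa [sub_eq_zero] using this
    · rintro (rfl | rfl | rfl)
      · ring
      · linear_combination (a - 1) * ht
      · linear_combination (t + 2) * ht - h2
  rw [this, Set.ncard_insert_of_notMem, Set.ncard_pair]
  · simp
  · simp [ht0, ht1.symm]

/-- The Fermat cubic surface in characteristic two contains exactly `27` lines over any field
containing a primitive cube root of unity. -/
theorem ncard_fermat_lines {t : K} (ht : t ^ 2 + t + 1 = 0) :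
    {W : Submodule K (Fin 4 → K) | Module.finrank K W = 2 ∧
      ∀ v ∈ W, v 0 ^ 3 + v 1 ^ 3 + v 2 ^ 3 + v 3 ^ 3 = 0}.ncard = 27 := by
  set S : Set K := {a : K | a ^ 3 = 1} with hS
  have himage : {W : Submodule K (Fin 4 → K) | Module.finrank K W = 2 ∧
      ∀ v ∈ W, v 0 ^ 3 + v 1 ^ 3 + v 2 ^ 3 + v 3 ^ 3 = 0} =
      (fun x : Fin 3 × K × K ↦ fermatLine x.1 x.2.1 x.2.2) '' (Set.univ ×ˢ S ×ˢ S) := by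
    ext W
    constructor
    · rintro ⟨hd, hW⟩
      obtain ⟨p, α, β, hα, hβ, hle⟩ := exists_le_fermatLine ht hd hW
      exact ⟨(p, α, β), ⟨Set.mem_univ _, hα, hβ⟩,
        (Submodule.eq_of_le_of_finrank_eq hle (by rw [hd, finrank_fermatLine])).symm⟩
    · rintro ⟨⟨p, α, β⟩, ⟨-, hα, hβ⟩, rfl⟩
      exact ⟨finrank_fermatLine p α β, fun v hv ↦ fermat_eq_zero_of_mem_fermatLine hα hβ hv⟩
  rw [himage, Set.InjOn.ncard_image, Set.ncard_prod, Set.ncard_prod, ncard_cubeRoots_one ht,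
    Set.ncard_univ, Nat.card_fin]
  rintro ⟨p, α, β⟩ ⟨-, hα, -⟩ ⟨q, γ, δ⟩ - h
  have hα0 : α ≠ 0 := by rintro rfl; simp [hS] at hα
  obtain ⟨rfl, rfl, rfl⟩ := eq_of_fermatLine_eq hα0 h
  rfl

end FermatCubic

/-- If `θ = c³` with `c ≠ 0`, rescaling the last coordinate matches the lines of
`X³ + Y³ + Z³ + θW³` with those of the Fermat cubic. -/
lemma ncard_lines_f₃_eq {K : Type*} [Field K] {θ c : K} (hc : c ≠ 0) (hθ : c ^ 3 = θ) :
    {W : Submodule K (Fin 4 → K) | Module.finrank K W = 2 ∧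
      ∀ v ∈ W, eval v (f₃ K θ) = 0}.ncard =
    {W : Submodule K (Fin 4 → K) | Module.finrank K W = 2 ∧
      ∀ v ∈ W, v 0 ^ 3 + v 1 ^ 3 + v 2 ^ 3 + v 3 ^ 3 = 0}.ncard := by
  let e : (Fin 4 → K) ≃ₗ[K] (Fin 4 → K) :=
    LinearEquiv.piCongrRight fun i ↦
      LinearEquiv.smulOfNeZero K K (![1, 1, 1, c] i) (by fin_cases i <;> simp [hc])
  have he : ∀ v, e v 0 ^ 3 + e v 1 ^ 3 + e v 2 ^ 3 + e v 3 ^ 3 = eval v (f₃ K θ) := by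
    intro v
    simp [e, f₃, ← hθ, mul_pow]
  refine Set.ncard_congr (fun W _ ↦ W.map e.toLinearMap) ?_ ?_ ?_
  · rintro W ⟨hd, hW⟩
    refine ⟨by rw [← hd]; exact LinearEquiv.finrank_map_eq e W, ?_⟩
    rintro _ ⟨v, hv, rfl⟩
    exact (he v).trans (hW v hv)
  · intro V W _ _ h
    exact Submodule.map_injective_of_injective e.injective h
  · rintro W ⟨hd, hW⟩
    refine ⟨W.map e.symm.toLinearMap, ⟨by rw [← hd]; exact LinearEquiv.finrank_map_eq e.symm W, ?_⟩,
      ?_⟩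
    · rintro _ ⟨v, hv, rfl⟩
      rw [← he]
      simpa using hW v hv
    · rw [← Submodule.map_comp]
      simp

/-- A cube root of unity in a finite field `K` is a cube when `9` divides `#K - 1`. -/
lemma exists_cube_eq_of_cube_eq_one {K : Type*} [Field K] [Finite K]
    (hK : 9 ∣ Nat.card K - 1) {t : K} (ht : t ^ 3 = 1) : ∃ c : K, c ^ 3 = t := by
  have ht0 : t ≠ 0 := by rintro rfl; simp at ht
  obtain ⟨g, hg⟩ := IsCyclic.exists_generator (α := Kˣ)
  obtain ⟨n, hn⟩ := (Submonoid.mem_powers_iff _ _).mp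
    (mem_powers_iff_mem_zpowers.mpr (hg (Units.mk0 t ht0)))
  have hg9 : 9 ∣ orderOf g := by
    rwa [orderOf_eq_card_of_forall_mem_zpowers hg, Nat.card_units]
  have h3 : g ^ (n * 3) = 1 := by
    rw [pow_mul, hn]
    ext
    simpa using ht
  obtain ⟨m, rfl⟩ : 3 ∣ n := by
    have := hg9.trans (orderOf_dvd_of_pow_eq_one h3)
    omega
  refine ⟨((g ^ m : Kˣ) : K), ?_⟩
  rw [← Units.val_pow_eq_pow_val, ← pow_mul, mul_comm, hn, Units.val_mk0]

/-- For each `θ ∈ 𝔽₄` with `θ² + θ + 1 = 0`, all `27` lines of the cubic surface `S₃(θ)` are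
defined over `𝔽₆₄`: there are exactly `27` two-dimensional `𝔽₆₄`-linear subspaces of `𝔽₆₄⁴` on
which `f₃` (with coefficients viewed in `𝔽₆₄` via an embedding `𝔽₄ → 𝔽₆₄`) vanishes
identically. -/
theorem S₃_card_lines_over_F64 (θ : GaloisField 2 2) (hθ : θ ^ 2 + θ + 1 = 0)
    (ι : GaloisField 2 2 →+* GaloisField 2 6) :
    {W : Submodule (GaloisField 2 6) (Fin 4 → GaloisField 2 6) |
        Module.finrank (GaloisField 2 6) W = 2
          ∧ ∀ v ∈ W, eval v (f₃ (GaloisField 2 6) (ι θ)) = 0}.ncard = 27 := by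
  have ht : ι θ ^ 2 + ι θ + 1 = 0 := by simpa using congrArg ι hθ
  have ht3 : ι θ ^ 3 = 1 := by linear_combination (ι θ - 1) * ht
  obtain ⟨c, hc⟩ := exists_cube_eq_of_cube_eq_one
    (by rw [GaloisField.card 2 6 (by norm_num)]; norm_num) ht3
  have hc0 : c ≠ 0 := by
    rintro rfl
    simp [← hc] at ht3
  rw [ncard_lines_f₃_eq hc0 hc, ncard_fermat_lines ht]
end
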